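/- arXiv:1609.06290 — 3 statements merged into one kernel-verified Lean document; each statement's English description precedes it below -/
import Mathlib

section
/- Let op_0 op_1 ... op_n be a valid sequence of order-2 stack operations and 0 ≤ j ≤ n. If op_j = ↓1, then push1(j−1) ≥ 0, push1(j) = push1(push1(j−1) − 1), and Push2(j) = Push2(j−1). -/
/-- Order-2 stack operations over stack alphabet `S`. -/
inductive Op (S : Type) : Type where
  | push1 : S → Op S
  | pop1  : Op S
  | push2 : Op S
  | pop2  : Op S
  | collapse : Op S
  deriving DecidableEq

/-- Annotated stack symbol: (symbol, collapse link, position annotation). -/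
abbrev ASym (S : Type) : Type := S × ℕ × ℤ
/-- Annotated order-1 stack, topmost symbol first. -/
abbrev Stk1 (S : Type) : Type := List (ASym S)
/-- Annotated order-2 stack: list of (position annotation, order-1 stack), topmost first.
In `[[u_1][u_2] ⋯ [u_n]]` the topmost stack `u_n` comes first in the list. -/
abbrev Stk2 (S : Type) : Type := List (ℤ × Stk1 S)

/-- The initial order-2 stack `[[]]`, its unique (empty) order-1 stack annotated `-1`. -/
def initStk (S : Type) : Stk2 S := [(-1, ([] : Stk1 S))]

/-- One step of the annotated semantics; `p` is the current position.
`push1 s` records the collapse link `n-1` (number of stacks below the top) and the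
position annotation `p`; `push2` duplicates the top stack annotating the copy with `p`;
`collapse` keeps the bottom `i` order-1 stacks, where `i` is the collapse link of the
topmost symbol.  Undefined operations yield `none`. -/
def step {S : Type} (p : ℕ) (op : Op S) (W : Stk2 S) : Option (Stk2 S) :=
  match op, W with
  | .push2, t :: rest => some (((p : ℤ), t.2) :: t :: rest)
  | .pop2, _ :: t :: rest => some (t :: rest)
  | .push1 s, (a, u) :: rest => some ((a, (s, rest.length, (p : ℤ)) :: u) :: rest)
  | .pop1, (a, _ :: u) :: rest => some ((a, u) :: rest)
  | .collapse, (_, (_, i, _) :: _) :: _ =>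
      if 1 ≤ i ∧ i < W.length then some (W.drop (W.length - i)) else none
  | _, _ => none

def runFrom {S : Type} (p : ℕ) (W : Stk2 S) : List (Op S) → Option (Stk2 S)
  | [] => some W
  | op :: rest => (step p op W).bind fun W' => runFrom (p + 1) W' rest

/-- `stkAt ops j` is the annotated order-2 stack `W_j` after executing `op_0 ⋯ op_j`
(for `j = -1` this is the initial stack `[[]]`). -/
def stkAt {S : Type} (ops : List (Op S)) (j : ℤ) : Option (Stk2 S) :=
  runFrom 0 (initStk S) (ops.take (j + 1).toNat)

/-- A nonempty sequence of operations is valid if every operation is defined,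
starting from the empty order-2 stack `[[]]`. -/
def Valid {S : Type} (ops : List (Op S)) : Prop :=
  ops ≠ [] ∧ (runFrom 0 (initStk S) ops).isSome

/-- `push1At ops j` is `push1(j)`: the position annotation of the topmost symbol of the
topmost order-1 stack of `W_j`, or `-1` if that stack is empty (also `-1` for `j = -1`). -/
def push1At {S : Type} (ops : List (Op S)) (j : ℤ) : ℤ :=
  match stkAt ops j with
  | some ((_, (_, _, p) :: _) :: _) => p
  | _ => -1

/-- `Push2At ops j` is `Push2(j)`: the position annotation of the topmost order-1 stack
of `W_j` (`-1` for `j = -1`). -/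
def Push2At {S : Type} (ops : List (Op S)) (j : ℤ) : ℤ :=
  match stkAt ops j with
  | some ((a, _) :: _) => a
  | _ => -1

def topAnn {S : Type} : Stk1 S → ℤ
  | [] => -1
  | (_, _, p) :: _ => p

def GoodStk {S : Type} (ops : List (Op S)) : Stk1 S → Prop
  | [] => True
  | (_, _, p) :: v => (0 ≤ p ∧ push1At ops (p - 1) = topAnn v) ∧ GoodStk ops v

theorem runFrom_snoc {S : Type} (l : List (Op S)) (op : Op S) : ∀ (p : ℕ) (W : Stk2 S),
    runFrom p W (l ++ [op]) = (runFrom p W l).bind (step (p + l.length) op) := by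
  induction l with
  | nil => intro p W; simp [runFrom]
  | cons a l ih =>
    intro p W
    simp only [List.cons_append, runFrom, List.length_cons]
    cases h : step p a W with
    | none => rfl
    | some W' =>
      simp only [Option.bind_some]
      rw [ih]
      congr 2
      omega

theorem run_take_succ {S : Type} (ops : List (Op S)) (k : ℕ) (hk : k < ops.length) :
    runFrom 0 (initStk S) (ops.take (k + 1)) =
      (runFrom 0 (initStk S) (ops.take k)).bind (step k ops[k]) := by
  rw [← List.take_concat_get' ops k hk, runFrom_snoc]
  simp [List.length_take, Nat.min_eq_left hk.le]

theorem push1At_of {S : Type} (ops : List (Op S)) (j : ℤ) (k : ℕ) (hk : j + 1 = k)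
    (a : ℤ) (u : Stk1 S) (rest : Stk2 S)
    (h : runFrom 0 (initStk S) (ops.take k) = some ((a, u) :: rest)) :
    push1At ops j = topAnn u ∧ Push2At ops j = a := by
  have h' : stkAt ops j = some ((a, u) :: rest) := by
    unfold stkAt; rw [hk]; simpa using h
  unfold push1At Push2At
  rw [h']
  rcases u with _ | ⟨⟨s, i, p⟩, u⟩ <;> simp [topAnn]

theorem good_all {S : Type} (ops : List (Op S)) (k : ℕ) (hk : k ≤ ops.length) :
    ∀ W, runFrom 0 (initStk S) (ops.take k) = some W → ∀ t ∈ W, GoodStk ops t.2 := by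
  induction k with
  | zero =>
    intro W h t ht
    simp only [List.take_zero, runFrom, initStk, Option.some.injEq] at h
    subst h
    simp only [List.mem_singleton] at ht
    subst ht
    trivial
  | succ k ih =>
    intro W h t ht
    rw [run_take_succ ops k (by omega)] at h
    obtain ⟨V, hV, hs⟩ := Option.bind_eq_some_iff.1 h
    have ihV := ih (by omega) V hV
    generalize ops[k] = op at hs
    unfold step at hs
    split at hs
    · rename_i t0 rest
      simp only [Option.some.injEq] at hs
      subst hs
      simp only [List.mem_cons] at ht ihV
      rcases ht with rfl | ht
      · exact ihV t0 (Or.inl rfl)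
      · exact ihV _ ht
    · simp only [Option.some.injEq] at hs
      subst hs
      exact ihV _ (List.mem_cons_of_mem _ ht)
    · rename_i s a u rest
      simp only [Option.some.injEq] at hs
      subst hs
      rcases List.mem_cons.1 ht with rfl | ht
      · exact ⟨⟨by simp, (push1At_of ops _ k (by omega) a u rest hV).1⟩,
          ihV (a, u) List.mem_cons_self⟩
      · exact ihV _ (List.mem_cons_of_mem _ ht)
    · rename_i a x u rest
      simp only [Option.some.injEq] at hs
      subst hs
      rcases List.mem_cons.1 ht with rfl | ht
      · exact (ihV (a, x :: u) List.mem_cons_self).2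
      · exact ihV _ (List.mem_cons_of_mem _ ht)
    · split at hs
      · simp only [Option.some.injEq] at hs
        subst hs
        exact ihV _ (List.mem_of_mem_drop ht)
      · simp at hs
    · simp at hs

theorem valid_take {S : Type} (l m : List (Op S)) : ∀ (p : ℕ) (W : Stk2 S),
    (runFrom p W (l ++ m)).isSome → (runFrom p W l).isSome := by
  induction l with
  | nil => intro p W _; rfl
  | cons a l ih =>
    intro p W h
    simp only [List.cons_append, runFrom] at h ⊢
    cases hs : step p a W with
    | none => simp [hs] at h
    | some W' =>
      simp only [hs, Option.bind_some] at h ⊢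
      exact ih _ _ h

/-- In a valid sequence, if `op_j = ↓1` then `push1(j-1) ≥ 0`,
`push1(j) = push1(push1(j-1) - 1)`, and `Push2(j) = Push2(j-1)`. -/
theorem pop1_step_push1_Push2 {S : Type} (ops : List (Op S)) (hv : Valid ops)
    (j : ℕ) (hj : j < ops.length) (hop : ops[j]? = some Op.pop1) :
    0 ≤ push1At ops ((j : ℤ) - 1) ∧
    push1At ops (j : ℤ) = push1At ops (push1At ops ((j : ℤ) - 1) - 1) ∧
    Push2At ops (j : ℤ) = Push2At ops ((j : ℤ) - 1) := by
  have hop' : ops[j] = Op.pop1 := by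
    rw [List.getElem?_eq_getElem hj] at hop
    exact Option.some.inj hop
  have h1 : (runFrom 0 (initStk S) (ops.take (j + 1))).isSome :=
    valid_take _ (ops.drop (j + 1)) _ _ (by rw [List.take_append_drop]; exact hv.2)
  obtain ⟨W, hW⟩ := Option.isSome_iff_exists.1 h1
  have hW0 := hW
  rw [run_take_succ ops j hj, hop'] at hW
  obtain ⟨V, hV, hs⟩ := Option.bind_eq_some_iff.1 hW
  have hg := good_all ops j hj.le V hV
  rcases V with _ | ⟨⟨a, _ | ⟨⟨s, i, p⟩, u⟩⟩, rest⟩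
  · simp [step] at hs
  · simp [step] at hs
  · simp only [step, Option.some.injEq] at hs
    subst hs
    obtain ⟨⟨hp, hpu⟩, -⟩ := hg _ List.mem_cons_self
    obtain ⟨e1, e2⟩ := push1At_of ops ((j : ℤ) - 1) j (by omega) _ _ _ hV
    obtain ⟨e3, e4⟩ := push1At_of ops (j : ℤ) (j + 1) (by push_cast; rfl) _ _ _ hW0
    rw [e1, e2, e3, e4]
    exact ⟨hp, hpu.symm, rfl⟩
end

section
/- Let op_0 op_1 ... op_n be a valid sequence of order-2 stack operations and 0 ≤ j ≤ n. If op_j = ↓2, then Push2(j−1) ≥ 0, push1(j) = push1(Push2(j−1) − 1), and Push2(j) = Push2(Push2(j−1) − 1). -/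
/-- Every non-bottom order-1 stack annotated `p` sits on the stack `f p`. -/
def SInv {S : Type} (f : ℕ → Option (Stk2 S)) : Stk2 S → Prop
  | [] => True
  | x :: r => (r ≠ [] → ∃ p : ℕ, x.1 = (p : ℤ) ∧ f p = some r) ∧ SInv f r

theorem SInv_drop {S : Type} (f : ℕ → Option (Stk2 S)) (W : Stk2 S) (h : SInv f W) (k : ℕ) :
    SInv f (W.drop k) := by
  induction k generalizing W with
  | zero => simpa using h
  | succ k ih =>
    cases W with
    | nil => simpa using h
    | cons x r => exact ih r h.2

theorem SInv_step {S : Type} (f : ℕ → Option (Stk2 S)) (k : ℕ) (op : Op S) (W W' : Stk2 S)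
    (h : SInv f W) (hf : f k = some W) (hs : step k op W = some W') : SInv f W' := by
  unfold step at hs
  split at hs
  · cases hs
    exact ⟨fun _ => ⟨k, rfl, hf⟩, h⟩
  · cases hs
    exact h.2
  · cases hs
    exact ⟨h.1, h.2⟩
  · cases hs
    exact ⟨h.1, h.2⟩
  · split at hs
    · cases hs
      exact SInv_drop f _ h _
    · cases hs
  · cases hs

theorem runFrom_append {S : Type} (l m : List (Op S)) (p : ℕ) (W : Stk2 S) :
    runFrom p W (l ++ m) = (runFrom p W l).bind fun W' => runFrom (p + l.length) W' m := by
  induction l generalizing p W with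
  | nil => simp [runFrom]
  | cons o l ih =>
    simp only [List.cons_append, runFrom, ih, Option.bind_assoc, List.length_cons]
    congr 1
    funext W'
    congr 1
    funext W''
    congr 1
    omega

theorem run_succ {S : Type} (ops : List (Op S)) (W : Stk2 S) (k : ℕ) (hk : k < ops.length) :
    runFrom 0 W (ops.take (k + 1)) = (runFrom 0 W (ops.take k)).bind (step k ops[k]) := by
  rw [← List.take_concat_get' ops k hk, runFrom_append]
  congr 1
  funext W'
  simp [runFrom, Nat.min_eq_left hk.le]

theorem run_inv {S : Type} (ops : List (Op S)) (k : ℕ) (hk : k ≤ ops.length) (W : Stk2 S)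
    (h : runFrom 0 (initStk S) (ops.take k) = some W) :
    SInv (fun p => runFrom 0 (initStk S) (ops.take p)) W := by
  induction k generalizing W with
  | zero =>
    simp only [List.take_zero, runFrom, initStk] at h
    cases h
    simp [SInv]
  | succ k ih =>
    rw [run_succ ops _ k hk, Option.bind_eq_some_iff] at h
    obtain ⟨V, hV, hs⟩ := h
    exact SInv_step _ k _ V W (ih (by omega) V hV) hV hs

theorem run_some {S : Type} (ops : List (Op S)) (hv : Valid ops) (k : ℕ) :
    ∃ W, runFrom 0 (initStk S) (ops.take k) = some W := by
  obtain ⟨V, hV⟩ := Option.isSome_iff_exists.1 hv.2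
  rw [← List.take_append_drop k ops, runFrom_append, Option.bind_eq_some_iff] at hV
  obtain ⟨W, hW, _⟩ := hV
  exact ⟨W, hW⟩

/-- In a valid sequence, if `op_j = ↓2` then `Push2(j-1) ≥ 0`,
`push1(j) = push1(Push2(j-1) - 1)`, and `Push2(j) = Push2(Push2(j-1) - 1)`. -/
theorem pop2_step_push1_Push2 {S : Type} (ops : List (Op S)) (hv : Valid ops)
    (j : ℕ) (hj : j < ops.length) (hop : ops[j]? = some Op.pop2) :
    0 ≤ Push2At ops ((j : ℤ) - 1) ∧
    push1At ops (j : ℤ) = push1At ops (Push2At ops ((j : ℤ) - 1) - 1) ∧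
    Push2At ops (j : ℤ) = Push2At ops (Push2At ops ((j : ℤ) - 1) - 1) := by
  obtain ⟨W', hW'⟩ := run_some ops hv (j + 1)
  have hj1 : stkAt ops (j : ℤ) = some W' := by
    rw [← hW']
    unfold stkAt
    congr 2
  have hrun := hW'
  rw [run_succ ops _ j hj, Option.bind_eq_some_iff] at hrun
  obtain ⟨W, hW, hs⟩ := hrun
  have hop' : ops[j] = Op.pop2 := by
    rw [List.getElem?_eq_getElem hj] at hop
    exact Option.some.inj hop
  rw [hop'] at hs
  have hj0 : stkAt ops ((j : ℤ) - 1) = some W := by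
    rw [← hW]
    unfold stkAt
    congr 2
    omega
  have hinv := run_inv ops j hj.le W hW
  match W, hs, hj0, hinv with
  | (a, u) :: t :: rest, hs, hj0, hinv =>
    have hs' : W' = t :: rest := by
      simp only [step] at hs
      exact (Option.some.inj hs).symm
    obtain ⟨p, hp, hf⟩ := hinv.1 (by simp)
    have hp' : a = (p : ℤ) := hp
    have hP : Push2At ops ((j : ℤ) - 1) = (p : ℤ) := by
      unfold Push2At
      rw [hj0]
      exact hp'
    have hst : stkAt ops ((p : ℤ) - 1) = stkAt ops (j : ℤ) := by
      rw [hj1, hs', ← hf]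
      unfold stkAt
      simp
    rw [hP]
    refine ⟨by omega, ?_, ?_⟩
    · unfold push1At
      rw [hst]
    · unfold Push2At
      rw [hst]
  | [], hs, _, _ => simp [step] at hs
  | [_], hs, _, _ => simp [step] at hs
end

section
/- Every collapse-free order-2 nested word of split-width at most k, viewed as a graph over edge labels {→, ↷1, ↷2} where → is the successor relation of the word, is the graph denoted by some special tree term using at most 2k colors; in particular it has special tree-width at most 2k − 1. -/
/-- The order-1 nesting relation `i ↷1 j` of the 2-NW generated by `ops`. -/
def Nest1 {S : Type} (ops : List (Op S)) (i j : ℕ) : Prop :=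
  ops[j]? = some Op.pop1 ∧ (i : ℤ) = push1At ops ((j : ℤ) - 1)

/-- The order-2 nesting relation `i ↷2 j` of the 2-NW generated by `ops`:
either `j` is a `↓2` popping the order-1 stack created at `i`, or `j` is a collapse
and `i ≥ 0` is the position annotation of one of the order-1 stacks removed by it
(the removed stacks are the topmost `|W_{j-1}| - |W_j|` ones). -/
def Nest2 {S : Type} (ops : List (Op S)) (i j : ℕ) : Prop :=
  (ops[j]? = some Op.pop2 ∧ (i : ℤ) = Push2At ops ((j : ℤ) - 1)) ∨
  (ops[j]? = some Op.collapse ∧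
    ∃ W W' : Stk2 S, stkAt ops ((j : ℤ) - 1) = some W ∧ stkAt ops (j : ℤ) = some W' ∧
      ∃ d : ℕ, d < W.length - W'.length ∧ ∃ e, W[d]? = some e ∧ e.1 = (i : ℤ))

/-- A split word piece: a finite set `V` of positions of the 2-NW together with the set
`E` of kept successor edges `(i, i+1)`.  Factors are the maximal `E`-chains. -/
structure Piece : Type where
  V : Finset ℕ
  E : Finset (ℕ × ℕ)

/-- The width of a piece: the number of factors, i.e. of positions with no incoming
kept successor edge. -/
def Piece.width (G : Piece) : ℕ :=
  (G.V.filter (fun i => ∀ j ∈ G.V, (j, i) ∉ G.E)).card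

/-- Adjacency in the graph of a piece: kept successor edges together with the nesting
edges `↷1`, `↷2` between positions of the piece. -/
def adjP {S : Type} (ops : List (Op S)) (G : Piece) (i j : ℕ) : Prop :=
  ((i, j) ∈ G.E ∨ (j, i) ∈ G.E) ∨
  (i ∈ G.V ∧ j ∈ G.V ∧
    (Nest1 ops i j ∨ Nest1 ops j i ∨ Nest2 ops i j ∨ Nest2 ops j i))

/-- A piece is connected if any two of its positions are linked by a path of successor
or nesting edges. -/
def PConn {S : Type} (ops : List (Op S)) (G : Piece) : Prop :=
  ∀ i ∈ G.V, ∀ j ∈ G.V, Relation.ReflTransGen (adjP ops G) i j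

/-- A piece is atomic if it is (nonempty and) connected and all its factors are
singletons. -/
def Atomic {S : Type} (ops : List (Op S)) (G : Piece) : Prop :=
  G.V.Nonempty ∧ PConn ops G ∧ G.E = ∅

/-- `SWle ops G k`: there is a split-tree of width at most `k` rooted at the piece `G`,
i.e. Eve wins the split game from `G` with cost at most `k`.  Unary nodes are Eve's moves
(splitting some factors, making the piece disconnected); binary nodes are Adam's moves
(dividing a disconnected piece into two mutually disconnected nonempty parts). -/
inductive SWle {S : Type} (ops : List (Op S)) : Piece → ℕ → Prop where
  | atomic (G : Piece) (k : ℕ) :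
      Atomic ops G → G.width ≤ k → SWle ops G k
  | split (G G' : Piece) (k : ℕ) :
      G'.V = G.V → G'.E ⊆ G.E → ¬ PConn ops G' →
      G.width ≤ k → SWle ops G' k → SWle ops G k
  | divide (G G₁ G₂ : Piece) (k : ℕ) :
      G.V = G₁.V ∪ G₂.V → Disjoint G₁.V G₂.V →
      G₁.V.Nonempty → G₂.V.Nonempty →
      G.E = G₁.E ∪ G₂.E →
      (∀ i ∈ G₁.V, ∀ j ∈ G₂.V, ¬ adjP ops G i j) →
      G.width ≤ k → SWle ops G₁ k → SWle ops G₂ k → SWle ops G k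

/-- The unsplit piece corresponding to the whole 2-NW with `n` positions. -/
def fullPiece (n : ℕ) : Piece :=
  ⟨Finset.range n, (Finset.range (n - 1)).image (fun i => (i, i + 1))⟩

/-- Edge labels of the graph of a 2-NW: successor, order-1 nesting, order-2 nesting. -/
inductive ELab : Type where
  | succ : ELab
  | nest1 : ELab
  | nest2 : ELab
  deriving DecidableEq

/-- Special tree terms over vertex labels `A` and edge labels `ELab`, with colors in `ℕ`. -/
inductive STT (A : Type) : Type where
  | leaf : ℕ → A → STT A
  | add : ℕ → ℕ → ELab → STT A → STT A
  | forget : ℕ → STT A → STT A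
  | rename : ℕ → ℕ → STT A → STT A
  | plus : STT A → STT A → STT A

/-- All colors used by the term belong to `[k] = {1, …, k}`. -/
def STT.ColLe {A : Type} (k : ℕ) : STT A → Prop
  | .leaf i _ => 1 ≤ i ∧ i ≤ k
  | .add i j _ τ => 1 ≤ i ∧ i ≤ k ∧ 1 ≤ j ∧ j ≤ k ∧ τ.ColLe k
  | .forget i τ => 1 ≤ i ∧ i ≤ k ∧ τ.ColLe k
  | .rename i j τ => 1 ≤ i ∧ i ≤ k ∧ 1 ≤ j ∧ j ≤ k ∧ τ.ColLe k
  | .plus τ σ => τ.ColLe k ∧ σ.ColLe k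

/-- A colored `(A, ELab)`-labelled graph: vertices `0, …, n-1`, vertex labelling,
edge relations, and a partial injective assignment of vertices to colors. -/
structure CG (A : Type) : Type where
  n : ℕ
  lab : ℕ → A
  edge : ELab → ℕ → ℕ → Prop
  col : ℕ → Option ℕ

/-- Disjoint union of colored graphs (the vertices of the second graph are shifted). -/
def CG.disjUnion {A : Type} (G H : CG A) : CG A where
  n := G.n + H.n
  lab := fun x => if x < G.n then G.lab x else H.lab (x - G.n)
  edge := fun γ x y =>
    (x < G.n ∧ y < G.n ∧ G.edge γ x y) ∨
    (G.n ≤ x ∧ G.n ≤ y ∧ H.edge γ (x - G.n) (y - G.n))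
  col := fun c =>
    match G.col c with
    | some v => some v
    | none => (H.col c).map (G.n + ·)

attribute [local instance] Classical.propDecidable

/-- The colored graph denoted by a special tree term (`none` when undefined: `⊕` requires
the two arguments to use disjoint sets of colors). -/
noncomputable def STT.sem {A : Type} : STT A → Option (CG A)
  | .leaf i a =>
      some ⟨1, fun _ => a, fun _ _ _ => False, fun c => if c = i then some 0 else none⟩
  | .add i j γ τ => (STT.sem τ).map fun G =>
      match G.col i, G.col j with
      | some u, some v =>
          { G with edge := fun γ' x y => G.edge γ' x y ∨ (γ' = γ ∧ x = u ∧ y = v) }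
      | _, _ => G
  | .forget i τ => (STT.sem τ).map fun G =>
      { G with col := fun c => if c = i then none else G.col c }
  | .rename i j τ => (STT.sem τ).map fun G =>
      { G with col := fun c =>
          if c = i then G.col j else if c = j then G.col i else G.col c }
  | .plus τ σ => (STT.sem τ).bind fun G => (STT.sem σ).bind fun H =>
      if ∀ c, (G.col c).isSome → (H.col c) = none then some (G.disjUnion H) else none

/-! ### Helper material -/

/-- The term-definable colored graphs, seen on positions. `V` is the vertex set, `R` gives the
edges, `B` is the set of colored vertices and `c` gives their colors. -/
def Rlz {A : Type} (K : ℕ) (lab : List A) (V : Finset ℕ) (R : ELab → ℕ → ℕ → Prop)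
    (B : Finset ℕ) (c : ℕ → ℕ) : Prop :=
  ∃ τ : STT A, τ.ColLe K ∧ ∃ G : CG A, τ.sem = some G ∧ ∃ f : ℕ → ℕ,
    Set.BijOn f (Set.Iio G.n) (V : Set ℕ) ∧
    (∀ v, v < G.n → lab[f v]? = some (G.lab v)) ∧
    (∀ γ u v, u < G.n → v < G.n → (G.edge γ u v ↔ R γ (f u) (f v))) ∧
    (∀ x v, G.col x = some v ↔ v < G.n ∧ f v ∈ B ∧ c (f v) = x) ∧
    (∀ a ∈ B, 1 ≤ c a ∧ c a ≤ K)

theorem Rlz.congr {A : Type} {K : ℕ} {lab : List A} {V : Finset ℕ}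
    {R R' : ELab → ℕ → ℕ → Prop} {B : Finset ℕ} {c c' : ℕ → ℕ}
    (h : Rlz K lab V R B c) (hR : ∀ γ, ∀ a ∈ V, ∀ b ∈ V, (R γ a b ↔ R' γ a b))
    (hc : ∀ a ∈ B, c a = c' a) : Rlz K lab V R' B c' := by
  obtain ⟨τ, h1, G, h2, f, h3, h4, h5, h6, h7⟩ := h
  refine ⟨τ, h1, G, h2, f, h3, h4, ?_, ?_, ?_⟩
  · intro γ u v hu hv
    rw [h5 γ u v hu hv]
    exact hR γ _ (h3.mapsTo hu) _ (h3.mapsTo hv)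
  · intro x v
    rw [h6]
    constructor
    · rintro ⟨a, b, d⟩
      exact ⟨a, b, by rw [← hc _ b]; exact d⟩
    · rintro ⟨a, b, d⟩
      exact ⟨a, b, by rw [hc _ b]; exact d⟩
  · intro a ha
    rw [← hc a ha]
    exact h7 a ha

theorem Rlz.leaf {A : Type} {K : ℕ} {lab : List A} {a : ℕ} (ha : a < lab.length)
    {c : ℕ → ℕ} (hc : 1 ≤ c a ∧ c a ≤ K) :
    Rlz K lab {a} (fun _ _ _ => False) {a} c := by
  refine ⟨.leaf (c a) lab[a], hc, _, rfl, fun _ => a, ?_, ?_, ?_, ?_, ?_⟩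
  · refine ⟨?_, ?_, ?_⟩
    · intro x _
      simp
    · intro x hx y hy _
      simp at hx hy
      omega
    · intro x hx
      simp at hx
      exact ⟨0, by simp, hx.symm⟩
  · intro v _
    simp [ha]
  · intro γ u v _ _
    rfl
  · intro x v
    simp only [Finset.mem_singleton]
    constructor
    · intro h
      split_ifs at h with hx
      simp at h
      subst h
      exact ⟨by simp, trivial, hx.symm⟩
    · rintro ⟨h1, -, h3⟩
      have : v = 0 := by omega
      simp [h3, this]
  · intro b hb
    simp at hb
    subst hb
    exact hc

theorem Rlz.add {A : Type} {K : ℕ} {lab : List A} {V : Finset ℕ}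
    {R : ELab → ℕ → ℕ → Prop} {B : Finset ℕ} {c : ℕ → ℕ}
    (h : Rlz K lab V R B c) (γ : ELab) {a b : ℕ} (ha : a ∈ B) (hb : b ∈ B) (haV : a ∈ V)
    (hbV : b ∈ V) :
    Rlz K lab V (fun γ' x y => R γ' x y ∨ (γ' = γ ∧ x = a ∧ y = b)) B c := by
  obtain ⟨τ, h1, G, h2, f, h3, h4, h5, h6, h7⟩ := h
  obtain ⟨u, hu, rfl⟩ := h3.surjOn haV
  obtain ⟨v, hv, rfl⟩ := h3.surjOn hbV
  have hcu : G.col (c (f u)) = some u := (h6 _ _).2 ⟨hu, ha, rfl⟩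
  have hcv : G.col (c (f v)) = some v := (h6 _ _).2 ⟨hv, hb, rfl⟩
  refine ⟨.add (c (f u)) (c (f v)) γ τ, ⟨(h7 _ ha).1, (h7 _ ha).2, (h7 _ hb).1, (h7 _ hb).2, h1⟩,
    { G with edge := fun γ' x y => G.edge γ' x y ∨ (γ' = γ ∧ x = u ∧ y = v) }, ?_, f, h3, h4,
    ?_, h6, h7⟩
  · simp [STT.sem, h2, hcu, hcv]
  · intro γ' x y hx hy
    have e1 : x = u ↔ f x = f u := ⟨fun h => by rw [h], fun h => h3.injOn hx hu h⟩
    have e2 : y = v ↔ f y = f v := ⟨fun h => by rw [h], fun h => h3.injOn hy hv h⟩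
    simp only
    rw [h5 γ' x y hx hy, e1, e2]

theorem Rlz.forget {A : Type} {K : ℕ} {lab : List A} {V : Finset ℕ}
    {R : ELab → ℕ → ℕ → Prop} {B : Finset ℕ} {c : ℕ → ℕ}
    (h : Rlz K lab V R B c) (hBV : B ⊆ V) {a : ℕ} (ha : a ∈ B) :
    Rlz K lab V R (B.erase a) c := by
  obtain ⟨τ, h1, G, h2, f, h3, h4, h5, h6, h7⟩ := h
  obtain ⟨u, hu, rfl⟩ := h3.surjOn (hBV ha)
  have hcu : G.col (c (f u)) = some u := (h6 _ _).2 ⟨hu, ha, rfl⟩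
  refine ⟨.forget (c (f u)) τ, ⟨(h7 _ ha).1, (h7 _ ha).2, h1⟩,
    { G with col := fun x => if x = c (f u) then none else G.col x }, ?_, f, h3, h4, h5, ?_, ?_⟩
  · simp [STT.sem, h2]
  · intro x v
    simp only [Finset.mem_erase]
    constructor
    · intro h
      split_ifs at h with hx
      obtain ⟨p, q, r⟩ := (h6 _ _).1 h
      refine ⟨p, ⟨?_, q⟩, r⟩
      intro e
      exact hx (by rw [← r, e])
    · rintro ⟨p, ⟨q, r⟩, s⟩
      have hv : G.col x = some v := (h6 _ _).2 ⟨p, r, s⟩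
      rw [if_neg, hv]
      intro e
      rw [e, hcu] at hv
      apply q
      simp at hv
      rw [hv]
  · intro b hb
    exact h7 b (Finset.mem_of_mem_erase hb)

theorem Rlz.forgetTo {A : Type} {K : ℕ} {lab : List A} {V : Finset ℕ}
    {R : ELab → ℕ → ℕ → Prop} {c : ℕ → ℕ} {B' : Finset ℕ} (D : Finset ℕ) :
    ∀ B : Finset ℕ, Rlz K lab V R B c → B ⊆ V → B' ⊆ B → B \ B' = D → Rlz K lab V R B' c := by
  induction D using Finset.induction_on with
  | empty =>
    intro B h _ hB' hD
    have : B = B' := Finset.Subset.antisymm (Finset.sdiff_eq_empty_iff_subset.1 hD) hB'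
    rwa [← this]
  | insert a s has ih =>
    intro B h hBV hB' hD
    have ha : a ∈ B \ B' := by rw [hD]; simp
    rw [Finset.mem_sdiff] at ha
    refine ih (B.erase a) (h.forget hBV ha.1) ((Finset.erase_subset _ _).trans hBV) ?_ ?_
    · intro x hx
      rw [Finset.mem_erase]
      exact ⟨fun e => ha.2 (e ▸ hx), hB' hx⟩
    · ext x
      have := Finset.ext_iff.1 hD x
      simp only [Finset.mem_sdiff, Finset.mem_erase, Finset.mem_insert] at this ⊢
      constructor
      · rintro ⟨⟨p, q⟩, r⟩
        exact (this.1 ⟨q, r⟩).resolve_left p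
      · intro hx
        have h2 := this.2 (Or.inr hx)
        exact ⟨⟨fun e => has (e ▸ hx), h2.1⟩, h2.2⟩

theorem Rlz.swap {A : Type} {K : ℕ} {lab : List A} {V : Finset ℕ}
    {R : ELab → ℕ → ℕ → Prop} {B : Finset ℕ} {c : ℕ → ℕ}
    (h : Rlz K lab V R B c) {i j : ℕ} (hi : 1 ≤ i ∧ i ≤ K) (hj : 1 ≤ j ∧ j ≤ K) :
    Rlz K lab V R B (fun a => Equiv.swap i j (c a)) := by
  obtain ⟨τ, h1, G, h2, f, h3, h4, h5, h6, h7⟩ := h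
  refine ⟨.rename i j τ, ⟨hi.1, hi.2, hj.1, hj.2, h1⟩,
    { G with col := fun x => if x = i then G.col j else if x = j then G.col i else G.col x },
    ?_, f, h3, h4, h5, ?_, ?_⟩
  · simp [STT.sem, h2]
  · intro x v
    have e : (if x = i then G.col j else if x = j then G.col i else G.col x)
        = G.col (Equiv.swap i j x) := by
      rw [Equiv.swap_apply_def]
      split_ifs <;> rfl
    simp only
    rw [e, h6]
    have : c (f v) = Equiv.swap i j x ↔ Equiv.swap i j (c (f v)) = x := by
      rw [Equiv.swap_apply_eq_iff]
    rw [this]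
  · intro a ha
    have := h7 a ha
    simp only [Equiv.swap_apply_def]
    split_ifs <;> assumption

theorem Rlz.perm {A : Type} {K : ℕ} {lab : List A} {V : Finset ℕ}
    {R : ELab → ℕ → ℕ → Prop} {B : Finset ℕ} {c : ℕ → ℕ}
    (h : Rlz K lab V R B c) (σ : Equiv.Perm {x : ℕ // x ∈ Finset.Icc 1 K}) :
    Rlz K lab V R B (fun a => Equiv.Perm.ofSubtype σ (c a)) := by
  induction σ using Equiv.Perm.swap_induction_on with
  | one => simpa using h
  | swap_mul f x y hxy ih =>
    have hx := Finset.mem_Icc.1 x.2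
    have hy := Finset.mem_Icc.1 y.2
    have := ih.swap hx hy
    simpa [map_mul, Equiv.Perm.ofSubtype_swap_eq] using this

theorem Rlz.recolor {A : Type} {K : ℕ} {lab : List A} {V : Finset ℕ}
    {R : ELab → ℕ → ℕ → Prop} {B : Finset ℕ} {c c' : ℕ → ℕ}
    (h : Rlz K lab V R B c) (hBV : B ⊆ V) (hc' : Set.InjOn c' B)
    (hm : ∀ a ∈ B, 1 ≤ c' a ∧ c' a ≤ K) : Rlz K lab V R B c' := by
  have hm0 : ∀ a ∈ B, 1 ≤ c a ∧ c a ≤ K := by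
    obtain ⟨τ, h1, G, h2, f, h3, h4, h5, h6, h7⟩ := h
    exact h7
  have hc : Set.InjOn c B := by
    obtain ⟨τ, h1, G, h2, f, h3, h4, h5, h6, h7⟩ := h
    intro a ha b hb hab
    obtain ⟨u, hu, rfl⟩ := h3.surjOn (hBV ha)
    obtain ⟨v, hv, rfl⟩ := h3.surjOn (hBV hb)
    have e1 : G.col (c (f u)) = some u := (h6 _ _).2 ⟨hu, ha, rfl⟩
    have e2 : G.col (c (f v)) = some v := (h6 _ _).2 ⟨hv, hb, rfl⟩
    rw [hab, e2] at e1
    simp at e1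
    rw [e1]
  let g : B → {x : ℕ // x ∈ Finset.Icc 1 K} := fun a => ⟨c a, Finset.mem_Icc.2 (hm0 a a.2)⟩
  let g' : B → {x : ℕ // x ∈ Finset.Icc 1 K} := fun a => ⟨c' a, Finset.mem_Icc.2 (hm a a.2)⟩
  have hg : Function.Injective g := by
    intro a b hab
    have : c a = c b := congrArg Subtype.val hab
    exact Subtype.ext (hc a.2 b.2 this)
  have hg' : Function.Injective g' := by
    intro a b hab
    have : c' a = c' b := congrArg Subtype.val hab
    exact Subtype.ext (hc' a.2 b.2 this)
  let e : {x // x ∈ Set.range g} ≃ {x // x ∈ Set.range g'} :=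
    (Equiv.ofInjective g hg).symm.trans (Equiv.ofInjective g' hg')
  let σ := e.extendSubtype
  refine (h.perm σ).congr (fun _ _ _ _ _ => Iff.rfl) ?_
  intro a ha
  have h1 : σ (g ⟨a, ha⟩) = g' ⟨a, ha⟩ := by
    have := e.extendSubtype_apply_of_mem (g ⟨a, ha⟩) ⟨_, rfl⟩
    rw [show σ (g ⟨a, ha⟩) = _ from this]
    have h2 : (Equiv.ofInjective g hg).symm ⟨g ⟨a, ha⟩, ⟨_, rfl⟩⟩ = ⟨a, ha⟩ :=
      Equiv.ofInjective_symm_apply hg _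
    simp only [e, Equiv.trans_apply]
    rw [h2]
    rfl
  have h3 : Equiv.Perm.ofSubtype σ (c a) = (σ (g ⟨a, ha⟩) : ℕ) :=
    Equiv.Perm.ofSubtype_apply_of_mem σ (Finset.mem_Icc.2 (hm0 a ha))
  rw [h3, h1]

theorem Rlz.plus {A : Type} {K : ℕ} {lab : List A} {V₁ V₂ : Finset ℕ}
    {R : ELab → ℕ → ℕ → Prop} {B₁ B₂ : Finset ℕ} {c : ℕ → ℕ}
    (h : Rlz K lab V₁ R B₁ c) (h' : Rlz K lab V₂ R B₂ c)
    (hB₁ : B₁ ⊆ V₁) (hB₂ : B₂ ⊆ V₂) (hV : Disjoint V₁ V₂)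
    (hc : Set.InjOn c (B₁ ∪ B₂ : Finset ℕ))
    (hR : ∀ γ, ∀ a ∈ V₁, ∀ b ∈ V₂, ¬ R γ a b ∧ ¬ R γ b a) :
    Rlz K lab (V₁ ∪ V₂) R (B₁ ∪ B₂) c := by
  obtain ⟨τ, h1, G, h2, f, h3, h4, h5, h6, h7⟩ := h
  obtain ⟨τ', h1', G', h2', f', h3', h4', h5', h6', h7'⟩ := h'
  have hdis : ∀ x, x ∈ V₁ → x ∈ V₂ → False := fun x h h' => Finset.disjoint_left.1 hV h h'
  have hcol : ∀ x, (G.col x).isSome → G'.col x = none := by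
    intro x hx
    obtain ⟨u, hu⟩ := Option.isSome_iff_exists.1 hx
    by_contra hn
    obtain ⟨v, hv⟩ := Option.ne_none_iff_exists'.1 hn
    obtain ⟨p, q, r⟩ := (h6 _ _).1 hu
    obtain ⟨p', q', r'⟩ := (h6' _ _).1 hv
    have : f u = f' v := hc (by simp [q]) (by simp [q']) (r.trans r'.symm)
    exact hdis _ (hB₁ q) (this ▸ hB₂ q')
  have m1 : ∀ u, u < G.n → f u ∈ V₁ := fun u hu => h3.mapsTo hu
  have m2 : ∀ u, u < G'.n → f' u ∈ V₂ := fun u hu => h3'.mapsTo hu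
  refine ⟨.plus τ τ', ⟨h1, h1'⟩, G.disjUnion G', ?_,
    fun x => if x < G.n then f x else f' (x - G.n), ?_, ?_, ?_, ?_, ?_⟩
  · simp [STT.sem, h2, h2']
    exact fun x hx => hcol x hx
  · refine ⟨?_, ?_, ?_⟩
    · intro x hx
      have hx : x < G.n + G'.n := hx
      simp only [Finset.coe_union, Set.mem_union, Finset.mem_coe]
      split_ifs with hl
      · exact Or.inl (m1 _ hl)
      · exact Or.inr (m2 _ (by omega))
    · intro x hx y hy hxy
      have hx : x < G.n + G'.n := hx
      have hy : y < G.n + G'.n := hy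
      simp only at hxy
      split_ifs at hxy with p q q
      · exact h3.injOn p q hxy
      · exact (hdis _ (m1 _ p) (hxy ▸ m2 _ (by omega))).elim
      · exact (hdis _ (m1 _ q) (hxy ▸ m2 _ (by omega))).elim
      · have a1 : x - G.n < G'.n := by omega
        have a2 : y - G.n < G'.n := by omega
        have := h3'.injOn a1 a2 hxy
        omega
    · intro a ha
      simp only [Finset.coe_union, Set.mem_union] at ha
      rcases ha with ha | ha
      · obtain ⟨u, hu, rfl⟩ := h3.surjOn ha
        have hu : u < G.n := hu
        refine ⟨u, ?_, by simp [hu]⟩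
        show u < G.n + G'.n
        omega
      · obtain ⟨u, hu, rfl⟩ := h3'.surjOn ha
        have hu : u < G'.n := hu
        refine ⟨G.n + u, ?_, by simp⟩
        show G.n + u < G.n + G'.n
        omega
  · intro v hv
    have hv : v < G.n + G'.n := hv
    simp only [CG.disjUnion]
    split_ifs with p
    · exact h4 v p
    · exact h4' _ (by omega)
  · intro γ u v hu hv
    have hu : u < G.n + G'.n := hu
    have hv : v < G.n + G'.n := hv
    simp only [CG.disjUnion]
    by_cases p : u < G.n <;> by_cases q : v < G.n
    · simp only [p, q, if_true, true_and]
      rw [h5 γ u v p q]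
      constructor
      · rintro (h | h)
        · exact h
        · omega
      · exact Or.inl
    · simp only [p, q, if_true, if_false]
      have := (hR γ _ (m1 u p) _ (m2 (v - G.n) (by omega))).1
      constructor
      · rintro (h | h)
        · exact h.2.1.elim
        · omega
      · intro h
        exact (this h).elim
    · simp only [p, q, if_true, if_false]
      have := (hR γ _ (m1 v q) _ (m2 (u - G.n) (by omega))).2
      constructor
      · rintro (h | h)
        · exact h.1.elim
        · omega
      · intro h
        exact (this h).elim
    · simp only [p, q, if_false, false_and, false_or]
      rw [h5' γ _ _ (by omega) (by omega)]
      constructor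
      · exact fun h => h.2.2
      · exact fun h => ⟨by omega, by omega, h⟩
  · intro x v
    simp only [CG.disjUnion, Finset.mem_union]
    cases hx : G.col x with
    | some u =>
      have hx' := hcol x (by simp [hx])
      obtain ⟨p, q, r⟩ := (h6 _ _).1 hx
      simp only [Option.some.injEq]
      constructor
      · rintro rfl
        exact ⟨by omega, by simp [p, q], by simp [p, r]⟩
      · rintro ⟨p', q', r'⟩
        split_ifs at q' r' with hl
        · rcases q' with q' | q'
          · have := (h6 x v).2 ⟨hl, q', r'⟩
            rw [hx] at this
            simpa using this
          · exact (hdis _ (m1 _ hl) (hB₂ q')).elim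
        · rcases q' with q' | q'
          · exact (hdis _ (hB₁ q') (m2 _ (by omega))).elim
          · have := (h6' x (v - G.n)).2 ⟨by omega, q', r'⟩
            rw [hx'] at this
            simp at this
    | none =>
      simp only [Option.map_eq_some_iff]
      constructor
      · rintro ⟨u, hu, rfl⟩
        obtain ⟨p, q, r⟩ := (h6' _ _).1 hu
        exact ⟨by omega, by simp [q], by simp [r]⟩
      · rintro ⟨p', q', r'⟩
        split_ifs at q' r' with hl
        · rcases q' with q' | q'
          · have := (h6 x v).2 ⟨hl, q', r'⟩
            rw [hx] at this
            simp at this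
          · exact (hdis _ (m1 _ hl) (hB₂ q')).elim
        · rcases q' with q' | q'
          · exact (hdis _ (hB₁ q') (m2 _ (by omega))).elim
          · exact ⟨v - G.n, (h6' x (v - G.n)).2 ⟨by omega, q', r'⟩, by omega⟩
  · intro a ha
    rcases Finset.mem_union.1 ha with ha | ha
    · exact h7 a ha
    · exact h7' a ha

theorem Rlz.addMany {A : Type} {K : ℕ} {lab : List A} {V : Finset ℕ}
    {R : ELab → ℕ → ℕ → Prop} {B : Finset ℕ} {c : ℕ → ℕ}
    (h : Rlz K lab V R B c) (hBV : B ⊆ V) (T : Finset (ELab × ℕ × ℕ))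
    (hT : ∀ t ∈ T, t.2.1 ∈ B ∧ t.2.2 ∈ B) :
    Rlz K lab V (fun γ x y => R γ x y ∨ (γ, x, y) ∈ T) B c := by
  induction T using Finset.induction_on with
  | empty => simpa using h
  | insert t s hts ih =>
    have h1 := ih (fun t ht => hT t (Finset.mem_insert_of_mem ht))
    obtain ⟨ha, hb⟩ := hT t (Finset.mem_insert_self _ _)
    refine (h1.add t.1 ha hb (hBV ha) (hBV hb)).congr ?_ (fun _ _ => rfl)
    intro γ x _ y _
    rw [Finset.mem_insert]
    obtain ⟨t1, t2, t3⟩ := t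
    simp only [Prod.mk.injEq]
    tauto

theorem Rlz.addTo {A : Type} {K : ℕ} {lab : List A} {V : Finset ℕ}
    {R R' : ELab → ℕ → ℕ → Prop} {B : Finset ℕ} {c : ℕ → ℕ}
    (h : Rlz K lab V R B c) (hBV : B ⊆ V)
    (h1 : ∀ γ, ∀ a ∈ V, ∀ b ∈ V, R γ a b → R' γ a b)
    (h2 : ∀ γ, ∀ a ∈ V, ∀ b ∈ V, R' γ a b → ¬ R γ a b → a ∈ B ∧ b ∈ B) :
    Rlz K lab V R' B c := by
  let L : Finset ELab := {ELab.succ, ELab.nest1, ELab.nest2}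
  have hL : ∀ γ, γ ∈ L := by
    intro γ
    cases γ <;> simp [L]
  let T : Finset (ELab × ℕ × ℕ) :=
    (L ×ˢ (V ×ˢ V)).filter (fun t => R' t.1 t.2.1 t.2.2 ∧ ¬ R t.1 t.2.1 t.2.2)
  refine (h.addMany hBV T ?_).congr ?_ (fun _ _ => rfl)
  · intro t ht
    simp only [T, Finset.mem_filter, Finset.mem_product] at ht
    exact h2 _ _ ht.1.2.1 _ ht.1.2.2 ht.2.1 ht.2.2
  · intro γ a ha b hb
    simp only [T, Finset.mem_filter, Finset.mem_product, hL, ha, hb, true_and]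
    have := h1 γ a ha b hb
    tauto

theorem Rlz.discrete {A : Type} {K : ℕ} {lab : List A} {V : Finset ℕ} {c : ℕ → ℕ}
    (hV : V.Nonempty) (hl : ∀ a ∈ V, a < lab.length) (hc : Set.InjOn c V)
    (hm : ∀ a ∈ V, 1 ≤ c a ∧ c a ≤ K) :
    Rlz K lab V (fun _ _ _ => False) V c := by
  induction hV using Finset.Nonempty.cons_induction with
  | singleton a => exact Rlz.leaf (hl a (by simp)) (hm a (by simp))
  | cons a s h hs ih =>
    rw [Finset.cons_eq_insert, Finset.insert_eq] at *
    refine Rlz.plus (Rlz.leaf (hl a (by simp)) (hm a (by simp)))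
      (ih (fun b hb => hl b (by simp [hb])) (hc.mono ?_) (fun b hb => hm b (by simp [hb])))
      (Finset.Subset.refl _) (Finset.Subset.refl _) (by simpa using h) hc (by simp)
    simp

/-- The edge relations of a piece with kept successor edges `E`. -/
def pieceRel {S : Type} (ops : List (Op S)) (E : Finset (ℕ × ℕ)) : ELab → ℕ → ℕ → Prop
  | .succ, a, b => (a, b) ∈ E
  | .nest1, a, b => Nest1 ops a b
  | .nest2, a, b => Nest2 ops a b

/-- Left endpoints of factors. -/
noncomputable def lefts (V : Finset ℕ) (E : Finset (ℕ × ℕ)) : Finset ℕ :=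
  V.filter (fun i => ∀ j ∈ V, (j, i) ∉ E)

/-- Right endpoints of factors. -/
noncomputable def rights (V : Finset ℕ) (E : Finset (ℕ × ℕ)) : Finset ℕ :=
  V.filter (fun i => ∀ j ∈ V, (i, j) ∉ E)

/-- Endpoints of factors. -/
noncomputable def ends (V : Finset ℕ) (E : Finset (ℕ × ℕ)) : Finset ℕ :=
  lefts V E ∪ rights V E

theorem mem_ends {V : Finset ℕ} {E : Finset (ℕ × ℕ)} {a : ℕ} : a ∈ ends V E ↔
    a ∈ V ∧ ((∀ j ∈ V, (j, a) ∉ E) ∨ (∀ j ∈ V, (a, j) ∉ E)) := by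
  simp only [ends, lefts, rights, Finset.mem_union, Finset.mem_filter]
  tauto

theorem width_eq (G : Piece) : G.width = (lefts G.V G.E).card := by
  unfold Piece.width lefts
  congr

theorem rights_card {V : Finset ℕ} {E : Finset (ℕ × ℕ)} (hE : ∀ e ∈ E, e.2 = e.1 + 1) :
    (rights V E).card ≤ (lefts V E).card := by
  have h1 := Finset.card_filter_add_card_filter_not (s := V) (fun i => ∀ j ∈ V, (j, i) ∉ E)
  have h2 := Finset.card_filter_add_card_filter_not (s := V) (fun i => ∀ j ∈ V, (i, j) ∉ E)
  have h3 : (V.filter (fun i => ¬ ∀ j ∈ V, (j, i) ∉ E)).card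
      ≤ (V.filter (fun i => ¬ ∀ j ∈ V, (i, j) ∉ E)).card := by
    apply Finset.card_le_card_of_injOn (fun a => a - 1)
    · intro a ha
      simp only [Finset.coe_filter, Set.mem_ofPred_eq, not_forall, not_not] at ha ⊢
      obtain ⟨haV, j, hj, hja⟩ := ha
      have : a = j + 1 := hE _ hja
      subst this
      exact ⟨by simpa using hj, j + 1, haV, by simpa using hja⟩
    · intro a ha b hb hab
      simp only [Finset.coe_filter, Set.mem_ofPred_eq, not_forall, not_not] at ha hb
      obtain ⟨haV, j, hj, hja⟩ := ha
      obtain ⟨hbV, j', hj', hjb⟩ := hb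
      have e1 : a = j + 1 := hE _ hja
      have e2 : b = j' + 1 := hE _ hjb
      simp only at hab
      omega
  unfold rights lefts
  omega

theorem ends_card {V : Finset ℕ} {E : Finset (ℕ × ℕ)} (hE : ∀ e ∈ E, e.2 = e.1 + 1) :
    (ends V E).card ≤ 2 * (lefts V E).card := by
  have := Finset.card_union_le (lefts V E) (rights V E)
  have := rights_card (V := V) hE
  unfold ends
  omega

theorem exists_coloring (B : Finset ℕ) (K : ℕ) (h : B.card ≤ K) :
    ∃ c : ℕ → ℕ, Set.InjOn c B ∧ ∀ a ∈ B, 1 ≤ c a ∧ c a ≤ K := by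
  have h' : B.card ≤ (Finset.Icc 1 K).card := by simpa using h
  obtain ⟨D, hD, hcard⟩ := Finset.exists_subset_card_eq h'
  let e := Finset.equivOfCardEq hcard.symm
  refine ⟨fun a => if ha : a ∈ B then (e ⟨a, ha⟩ : ℕ) else 0, ?_, ?_⟩
  · intro a ha b hb hab
    have ha' : a ∈ B := ha
    have hb' : b ∈ B := hb
    simp only [ha', hb', dif_pos] at hab
    have := e.injective (Subtype.ext hab)
    simpa using this
  · intro a ha
    simp only [ha, dif_pos]
    exact Finset.mem_Icc.1 (hD (e ⟨a, ha⟩).2)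

/-- The step common to all nodes: adding successor edges and forgetting colors. -/
theorem Rlz.extend {S A : Type} {ops : List (Op S)} {K : ℕ} {lab : List A} {V : Finset ℕ}
    {E E' : Finset (ℕ × ℕ)} {c : ℕ → ℕ} (h : Rlz K lab V (pieceRel ops E) (ends V E) c)
    (hE : E ⊆ E') (hs : ∀ e ∈ E', e.2 = e.1 + 1) :
    Rlz K lab V (pieceRel ops E') (ends V E') c := by
  have hsub : ends V E ⊆ V := fun a ha => (mem_ends.1 ha).1
  refine Rlz.forgetTo _ (ends V E) (h.addTo hsub ?_ ?_) hsub ?_ rfl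
  · intro γ a _ b _ hab
    cases γ
    · exact hE hab
    · exact hab
    · exact hab
  · intro γ a ha b hb hab hn
    cases γ
    · have e1 : b = a + 1 := hs _ hab
      refine ⟨mem_ends.2 ⟨ha, Or.inr ?_⟩, mem_ends.2 ⟨hb, Or.inl ?_⟩⟩
      · intro j _ hj
        have e2 : j = a + 1 := hs _ (hE hj)
        exact hn (show (a, b) ∈ E by rw [e1, ← e2]; exact hj)
      · intro j _ hj
        have e2 : b = j + 1 := hs _ (hE hj)
        have e3 : a = j := by omega
        exact hn (show (a, b) ∈ E by rw [e3]; exact hj)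
    · exact (hn hab).elim
    · exact (hn hab).elim
  · intro a ha
    obtain ⟨p, q⟩ := mem_ends.1 ha
    exact mem_ends.2 ⟨p, q.imp (fun h j hj e => h j hj (hE e)) (fun h j hj e => h j hj (hE e))⟩

theorem SWle.rlz {S A : Type} {ops : List (Op S)} {lab : List A} {G : Piece} {k : ℕ}
    (h : SWle ops G k) : (∀ a ∈ G.V, a < lab.length) → ∀ E' : Finset (ℕ × ℕ), G.E ⊆ E' →
      (∀ e ∈ E', e.2 = e.1 + 1) →
      ∃ c, Rlz (2 * k) lab G.V (pieceRel ops E') (ends G.V E') c := by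
  induction h with
  | atomic G k hat hw =>
    intro hl E' hE hs
    obtain ⟨hne, -, hE0⟩ := hat
    have hcard : G.V.card ≤ 2 * k := by
      have : lefts G.V G.E = G.V := by
        simp [lefts, hE0]
      rw [width_eq, this] at hw
      omega
    obtain ⟨c, hc, hm⟩ := exists_coloring _ _ hcard
    have h0 := Rlz.discrete (lab := lab) hne hl hc hm
    refine ⟨c, Rlz.forgetTo _ G.V (h0.addTo (Finset.Subset.refl _) ?_ ?_)
      (Finset.Subset.refl _) (fun a ha => (mem_ends.1 ha).1) rfl⟩
    · intro _ _ _ _ _ h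
      exact h.elim
    · intro γ a ha b hb _ _
      exact ⟨ha, hb⟩
  | split G G' k hV hE hn hw _ ih =>
    intro hl E' hE' hs
    rw [← hV] at hl ⊢
    exact ih hl E' (hE.trans hE') hs
  | divide G G₁ G₂ k hV hd hn1 hn2 hE hadj hw _ _ ih1 ih2 =>
    intro hl E' hE' hs
    have hs0 : ∀ e ∈ G.E, e.2 = e.1 + 1 := fun e he => hs e (hE' he)
    have hi1 : ∀ a ∈ G₁.V, a ∈ G.V := fun a ha => by rw [hV]; exact Finset.mem_union_left _ ha
    have hi2 : ∀ a ∈ G₂.V, a ∈ G.V := fun a ha => by rw [hV]; exact Finset.mem_union_right _ ha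
    obtain ⟨c1, r1⟩ := ih1 (fun a ha => hl a (hi1 a ha)) G.E
      (by rw [hE]; exact Finset.subset_union_left) hs0
    obtain ⟨c2, r2⟩ := ih2 (fun a ha => hl a (hi2 a ha)) G.E
      (by rw [hE]; exact Finset.subset_union_right) hs0
    have hsub1 : ends G₁.V G.E ⊆ G₁.V := fun a ha => (mem_ends.1 ha).1
    have hsub2 : ends G₂.V G.E ⊆ G₂.V := fun a ha => (mem_ends.1 ha).1
    have hcross : ∀ γ, ∀ a ∈ G₁.V, ∀ b ∈ G₂.V,
        ¬ pieceRel ops G.E γ a b ∧ ¬ pieceRel ops G.E γ b a := by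
      intro γ a ha b hb
      have h1 := hadj a ha b hb
      have h2 := hi1 a ha
      have h3 := hi2 b hb
      unfold adjP at h1
      cases γ <;> simp only [pieceRel] <;> tauto
    have hends : ends G₁.V G.E ∪ ends G₂.V G.E = ends G.V G.E := by
      ext a
      rw [Finset.mem_union, mem_ends, mem_ends, mem_ends, hV]
      have hx : ∀ a ∈ G₁.V, ∀ b ∈ G₂.V, (a, b) ∉ G.E ∧ (b, a) ∉ G.E :=
        fun a ha b hb => hcross .succ a ha b hb
      have hdis : ∀ x, x ∈ G₁.V → x ∈ G₂.V → False := fun x h h' => Finset.disjoint_left.1 hd h h'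
      constructor
      · rintro (⟨p, q⟩ | ⟨p, q⟩)
        · refine ⟨Finset.mem_union_left _ p, q.imp ?_ ?_⟩
          · intro h j hj
            rcases Finset.mem_union.1 hj with hj | hj
            · exact h j hj
            · exact (hx a p j hj).2
          · intro h j hj
            rcases Finset.mem_union.1 hj with hj | hj
            · exact h j hj
            · exact (hx a p j hj).1
        · refine ⟨Finset.mem_union_right _ p, q.imp ?_ ?_⟩
          · intro h j hj
            rcases Finset.mem_union.1 hj with hj | hj
            · exact (hx j hj a p).1
            · exact h j hj
          · intro h j hj
            rcases Finset.mem_union.1 hj with hj | hj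
            · exact (hx j hj a p).2
            · exact h j hj
      · rintro ⟨p, q⟩
        rcases Finset.mem_union.1 p with p | p
        · exact Or.inl ⟨p, q.imp (fun h j hj => h j (Finset.mem_union_left _ hj))
            (fun h j hj => h j (Finset.mem_union_left _ hj))⟩
        · exact Or.inr ⟨p, q.imp (fun h j hj => h j (Finset.mem_union_right _ hj))
            (fun h j hj => h j (Finset.mem_union_right _ hj))⟩
    have hcard : (ends G₁.V G.E ∪ ends G₂.V G.E).card ≤ 2 * k := by
      rw [hends]
      have := ends_card (V := G.V) hs0
      rw [width_eq] at hw
      omega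
    obtain ⟨c, hc, hm⟩ := exists_coloring _ _ hcard
    have r1' := r1.recolor hsub1 (c' := c) (hc.mono (by simp))
      (fun a ha => hm a (Finset.mem_union_left _ ha))
    have r2' := r2.recolor hsub2 (c' := c) (hc.mono (by simp))
      (fun a ha => hm a (Finset.mem_union_right _ ha))
    have r := r1'.plus r2' hsub1 hsub2 hd hc hcross
    rw [hends, ← hV] at r
    exact ⟨c, r.extend hE' hs⟩

/-- Every collapse-free 2-NW of split-width at most `k`, viewed as a
graph over edge labels `{→, ↷1, ↷2}`, is (isomorphic to) the graph denoted by some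
special tree term using at most `2k` colors; in particular its special tree-width is at
most `2k - 1`. -/
theorem stt_of_splitwidth {S A : Type} (k : ℕ)
    (ops : List (Op S)) (lab : List A)
    (hv : Valid ops) (hcf : Op.collapse ∉ ops) (hlen : lab.length = ops.length)
    (hsw : SWle ops (fullPiece ops.length) k) :
    ∃ τ : STT A, τ.ColLe (2 * k) ∧
      ∃ G : CG A, τ.sem = some G ∧ G.n = ops.length ∧
        ∃ f : ℕ → ℕ, Set.BijOn f (Set.Iio G.n) (Set.Iio ops.length) ∧
          (∀ v, v < G.n → lab[f v]? = some (G.lab v)) ∧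
          (∀ u v, u < G.n → v < G.n →
            (G.edge .succ u v ↔ f v = f u + 1) ∧
            (G.edge .nest1 u v ↔ Nest1 ops (f u) (f v)) ∧
            (G.edge .nest2 u v ↔ Nest2 ops (f u) (f v))) := by
  obtain ⟨c, τ, h1, G, h2, f, h3, h4, h5, h6, h7⟩ := hsw.rlz (lab := lab)
    (by intro a ha; simp [fullPiece] at ha; omega) _ (Finset.Subset.refl _)
    (by
      intro e he
      simp only [fullPiece, Finset.mem_image] at he
      obtain ⟨i, -, rfl⟩ := he
      rfl)
  have hV : ((fullPiece ops.length).V : Set ℕ) = Set.Iio ops.length := by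
    ext x
    simp [fullPiece]
  rw [hV] at h3
  refine ⟨τ, h1, G, h2, ?_, f, h3, h4, ?_⟩
  · have := h3.ncard_eq
    simpa [Set.ncard_eq_toFinset_card'] using this
  · intro u v hu hv'
    refine ⟨?_, h5 .nest1 u v hu hv', h5 .nest2 u v hu hv'⟩
    rw [h5 .succ u v hu hv']
    have hfv : f v < ops.length := h3.mapsTo hv'
    simp only [pieceRel, fullPiece, Finset.mem_image, Finset.mem_range, Prod.mk.injEq]
    constructor
    · rintro ⟨i, -, e1, e2⟩
      omega
    · intro e
      exact ⟨f u, by omega, rfl, e.symm⟩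
end
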